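/- arXiv:2504.18273 — 3 statements merged into one kernel-verified Lean document; each statement's English description precedes it below -/
import Mathlib

section
/- Let N, M ∈ ℕ with M ≥ 1, let i_1, ..., i_M be independent random variables, each uniformly distributed on {1,...,N}, and let A ∈ ℝ^{N×N} have all entries a_{ij} ∈ [-1,1]. Then for every 0 < p < 1, with probability at least 1 − p: |(1/N²)·Σ_{j=1}^N Σ_{n=1}^N a_{jn} − (1/M²)·Σ_{m=1}^M Σ_{l=1}^M a_{i_m, i_l}| ≤ 2·√((2·log(1/p) + 2·log(2N) + 2·log 2)/M). -/
open MeasureTheory ProbabilityTheory in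
/-- **Hoeffding's lemma** for a function with values in `[-1, 1]` on a finite type. -/
lemma sum_exp_mul_sub_mean_le {α : Type*} [Fintype α] [Nonempty α] (f : α → ℝ)
    (hf : ∀ a, f a ∈ Set.Icc (-1 : ℝ) 1) (t : ℝ) :
    ∑ a, Real.exp (t * (f a - (Fintype.card α : ℝ)⁻¹ * ∑ b, f b)) ≤
      Fintype.card α * Real.exp (t ^ 2 / 2) := by
  let _ : MeasurableSpace α := ⊤
  have hcard : (0 : ℝ) < Fintype.card α := by exact_mod_cast Fintype.card_pos
  set μ : Measure α := (PMF.uniformOfFintype α).toMeasure with hμ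
  have hint (g : α → ℝ) : ∫ a, g a ∂μ = (Fintype.card α : ℝ)⁻¹ * ∑ a, g a := by
    rw [hμ, PMF.integral_eq_sum, Finset.mul_sum]
    simp
  have h := (hasSubgaussianMGF_of_mem_Icc (μ := μ) (X := f)
    (measurable_of_finite f).aemeasurable (ae_of_all _ hf)).mgf_le t
  rw [mgf, hint, hint, inv_mul_le_iff₀ hcard] at h
  refine h.trans_eq ?_
  norm_num

/-- One-sided **Hoeffding inequality** for sampling with replacement, in counting form. -/
lemma card_lt_sum_sub_mean_le {α ι : Type*} [Fintype α] [Nonempty α] [Fintype ι]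
    (f : α → ℝ) (hf : ∀ a, f a ∈ Set.Icc (-1 : ℝ) 1) {ε : ℝ} (hε : 0 ≤ ε) :
    (Set.ncard {i : ι → α | Fintype.card ι * ε <
        ∑ m, (f (i m) - (Fintype.card α : ℝ)⁻¹ * ∑ a, f a)} : ℝ) ≤
      (Fintype.card α : ℝ) ^ Fintype.card ι * Real.exp (-(Fintype.card ι * ε ^ 2 / 2)) := by
  classical
  set g : α → ℝ := fun a ↦ f a - (Fintype.card α : ℝ)⁻¹ * ∑ b, f b with hg
  set s : Finset (ι → α) := {i | Fintype.card ι * ε < ∑ m, g (i m)} with hs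
  have hncard : Set.ncard {i : ι → α | Fintype.card ι * ε < ∑ m, g (i m)} = s.card := by
    rw [← Set.ncard_coe_finset]
    simp [hs]
  rw [hncard]
  have hmarkov : s.card * Real.exp (ε * (Fintype.card ι * ε)) ≤
      ∑ i : ι → α, Real.exp (ε * ∑ m, g (i m)) := by
    rw [← nsmul_eq_mul]
    refine (Finset.card_nsmul_le_sum s _ _ fun i hi ↦ ?_).trans
      (Finset.sum_le_sum_of_subset_of_nonneg (Finset.subset_univ s) fun _ _ _ ↦ by positivity)
    have : Fintype.card ι * ε < ∑ m, g (i m) := by simpa [hs] using hi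
    gcongr
  have hprod : ∑ i : ι → α, Real.exp (ε * ∑ m, g (i m)) =
      (∑ a, Real.exp (ε * g a)) ^ Fintype.card ι := by
    simp_rw [Finset.mul_sum, Real.exp_sum]
    rw [← Finset.card_univ, ← Finset.prod_const, Finset.prod_univ_sum, Fintype.piFinset_univ]
  have hmgf : (∑ a, Real.exp (ε * g a)) ^ Fintype.card ι ≤
      (Fintype.card α * Real.exp (ε ^ 2 / 2)) ^ Fintype.card ι := by
    gcongr
    exact sum_exp_mul_sub_mean_le f hf ε
  rw [← le_div_iff₀ (Real.exp_pos _)] at hmarkov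
  refine hmarkov.trans ?_
  rw [div_le_iff₀ (Real.exp_pos _), hprod, mul_assoc, ← Real.exp_add]
  refine hmgf.trans_eq ?_
  rw [mul_pow, ← Real.exp_nat_mul]
  congr 2
  ring

/-- **Hoeffding's inequality** for sampling with replacement, in counting form. -/
lemma card_lt_abs_mean_sub_sampleMean_le {α ι : Type*} [Fintype α] [Nonempty α]
    [Fintype ι] [Nonempty ι]
    (f : α → ℝ) (hf : ∀ a, f a ∈ Set.Icc (-1 : ℝ) 1) {ε : ℝ} (hε : 0 ≤ ε) :
    (Set.ncard {i : ι → α | ε < |(Fintype.card α : ℝ)⁻¹ * ∑ a, f a -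
        (Fintype.card ι : ℝ)⁻¹ * ∑ m, f (i m)|} : ℝ) ≤
      2 * (Fintype.card α : ℝ) ^ Fintype.card ι *
        Real.exp (-(Fintype.card ι * ε ^ 2 / 2)) := by
  have hcard : (0 : ℝ) < Fintype.card ι := by exact_mod_cast Fintype.card_pos
  have hup := card_lt_sum_sub_mean_le (ι := ι) f hf hε
  have hlow := card_lt_sum_sub_mean_le (ι := ι) (fun a ↦ - f a)
    (fun a ↦ ⟨neg_le_neg (hf a).2, by linarith [(hf a).1]⟩) hε
  have hsub : {i : ι → α | ε < |(Fintype.card α : ℝ)⁻¹ * ∑ a, f a -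
        (Fintype.card ι : ℝ)⁻¹ * ∑ m, f (i m)|} ⊆
      {i : ι → α | Fintype.card ι * ε <
        ∑ m, (f (i m) - (Fintype.card α : ℝ)⁻¹ * ∑ a, f a)} ∪
      {i : ι → α | Fintype.card ι * ε <
        ∑ m, (-f (i m) - (Fintype.card α : ℝ)⁻¹ * ∑ a, -f a)} := by
    intro i hi
    have hS : ∑ m, f (i m) = Fintype.card ι * ((Fintype.card ι : ℝ)⁻¹ * ∑ m, f (i m)) := by
      field_simp
    simp only [Set.mem_union, Set.mem_ofPred_eq, Finset.sum_sub_distrib, Finset.sum_neg_distrib,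
      Finset.sum_const, Finset.card_univ, nsmul_eq_mul] at hi ⊢
    rw [hS]
    rcases lt_abs.1 hi with h | h
    · right
      nlinarith
    · left
      nlinarith
  have hle := (Set.ncard_le_ncard hsub (Set.toFinite _)).trans (Set.ncard_union_le _ _)
  have hle' := (Nat.cast_le (α := ℝ)).2 hle
  push_cast at hle'
  linarith

/-- The double mean of a matrix is close to the double mean over a sample if the mean of the row
means and the mean of each row are close to the respective sample means. -/
lemma abs_mean_sub_sampleMean_le {α ι : Type*} [Fintype α] [Fintype ι] [Nonempty ι]
    (A : Matrix α α ℝ) (i : ι → α) {ε : ℝ}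
    (hmean : |(Fintype.card α : ℝ)⁻¹ * ∑ j, (Fintype.card α : ℝ)⁻¹ * ∑ n, A j n -
      (Fintype.card ι : ℝ)⁻¹ * ∑ m, (Fintype.card α : ℝ)⁻¹ * ∑ n, A (i m) n| ≤ ε)
    (hrow : ∀ j, |(Fintype.card α : ℝ)⁻¹ * ∑ n, A j n -
      (Fintype.card ι : ℝ)⁻¹ * ∑ l, A j (i l)| ≤ ε) :
    |((Fintype.card α : ℝ) ^ 2)⁻¹ * ∑ j, ∑ n, A j n -
      ((Fintype.card ι : ℝ) ^ 2)⁻¹ * ∑ m, ∑ l, A (i m) (i l)| ≤ 2 * ε := by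
  have hcard : (0 : ℝ) < Fintype.card ι := by exact_mod_cast Fintype.card_pos
  have hsample : |(Fintype.card ι : ℝ)⁻¹ * ∑ m, ((Fintype.card α : ℝ)⁻¹ * ∑ n, A (i m) n -
      (Fintype.card ι : ℝ)⁻¹ * ∑ l, A (i m) (i l))| ≤ ε := by
    rw [abs_mul, abs_of_pos (inv_pos.2 hcard), inv_mul_le_iff₀ hcard]
    refine (Finset.abs_sum_le_sum_abs _ _).trans ?_
    refine (Finset.sum_le_card_nsmul _ _ ε fun m _ ↦ hrow (i m)).trans_eq ?_
    simp
  refine (le_of_eq ?_).trans ((abs_add_le _ _).trans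
    ((add_le_add hmean hsample).trans_eq (two_mul ε).symm))
  congr 1
  simp only [Finset.sum_sub_distrib, ← Finset.mul_sum]
  ring

/-- **Two-dimensional Monte Carlo approximation lemma.**
If `i_1, …, i_M` are independent uniform samples from `{1, …, N}` (realized as uniformly
random tuples `i : Fin M → Fin N`, with probability stated by counting tuples) and
`A ∈ [-1,1]^{N×N}` (not necessarily symmetric), then for every `0 < p < 1`, with
probability at least `1 - p`,
`|N⁻² ∑_{j,n} a_{jn} - M⁻² ∑_{m,l} a_{i_m, i_l}| ≤ 2√((2 log(1/p) + 2 log(2N) + 2 log 2)/M)`. -/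
theorem monte_carlo_2d
    (N M : ℕ) (hN : 0 < N) (hM : 1 ≤ M)
    (A : Matrix (Fin N) (Fin N) ℝ) (hA : ∀ i j, A i j ∈ Set.Icc (-1 : ℝ) 1)
    (p : ℝ) (hp0 : 0 < p) (hp1 : p < 1) :
    ((Set.ncard {i : Fin M → Fin N |
        |((N : ℝ) ^ 2)⁻¹ * ∑ j, ∑ n, A j n -
            ((M : ℝ) ^ 2)⁻¹ * ∑ m : Fin M, ∑ l : Fin M, A (i m) (i l)| ≤
          2 * Real.sqrt ((2 * Real.log (1 / p) + 2 * Real.log (2 * N) + 2 * Real.log 2) / M)} : ℝ)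
      ≥ (1 - p) * (N : ℝ) ^ M) := by
  have : Nonempty (Fin N) := ⟨⟨0, hN⟩⟩
  have : Nonempty (Fin M) := ⟨⟨0, hM⟩⟩
  have hN1 : (1 : ℝ) ≤ N := by exact_mod_cast hN
  have hM0 : (0 : ℝ) < M := by exact_mod_cast hM
  set B : ℝ := 2 * Real.log (1 / p) + 2 * Real.log (2 * N) + 2 * Real.log 2 with hB
  set ε : ℝ := Real.sqrt (B / M) with hε
  have hB0 : 0 ≤ B := by
    have h1 : 0 ≤ Real.log (1 / p) := Real.log_nonneg ((one_le_div hp0).2 hp1.le)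
    have h2 : 0 ≤ Real.log (2 * N) := Real.log_nonneg (by linarith)
    have h3 : 0 ≤ Real.log 2 := Real.log_nonneg (by norm_num)
    positivity
  have hexp : Real.exp (-(M * ε ^ 2 / 2)) = p / (4 * N) := by
    have hlog : -(M * ε ^ 2 / 2) = Real.log (p / (4 * N)) := by
      rw [hε, Real.sq_sqrt (by positivity), mul_div_cancel₀ _ hM0.ne', hB,
        Real.log_div hp0.ne' (by positivity), one_div, Real.log_inv,
        show (4 : ℝ) * N = 2 * N * 2 by ring, Real.log_mul (by positivity) two_ne_zero]
      ring
    rw [hlog, Real.exp_log (by positivity)]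
  let rowMean : Fin N → ℝ := fun j ↦ (N : ℝ)⁻¹ * ∑ n, A j n
  have hrowMean (j : Fin N) : rowMean j ∈ Set.Icc (-1 : ℝ) 1 := by
    have habs : |∑ n, A j n| ≤ N := by
      refine (Finset.abs_sum_le_sum_abs _ _).trans
        ((Finset.sum_le_card_nsmul _ _ 1 fun n _ ↦ abs_le.2 (hA j n)).trans_eq ?_)
      simp
    rw [Set.mem_Icc, ← abs_le, abs_mul, abs_of_pos (by positivity),
      inv_mul_le_iff₀ (by positivity), mul_one]
    exact habs
  let bad (f : Fin N → ℝ) : Set (Fin M → Fin N) :=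
    {i | ε < |(N : ℝ)⁻¹ * ∑ a, f a - (M : ℝ)⁻¹ * ∑ m, f (i m)|}
  have hbad (f : Fin N → ℝ) (hf : ∀ a, f a ∈ Set.Icc (-1 : ℝ) 1) :
      ((bad f).ncard : ℝ) ≤ (N : ℝ) ^ M * (p / (2 * N)) := by
    have h := card_lt_abs_mean_sub_sampleMean_le (ι := Fin M) f hf (Real.sqrt_nonneg (B / M))
    simp only [Fintype.card_fin] at h
    refine h.trans_eq ?_
    rw [hexp]
    field_simp
    norm_num
  set good : Set (Fin M → Fin N) := {i | |((N : ℝ) ^ 2)⁻¹ * ∑ j, ∑ n, A j n -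
    ((M : ℝ) ^ 2)⁻¹ * ∑ m : Fin M, ∑ l : Fin M, A (i m) (i l)| ≤ 2 * ε} with hgood
  have hsub : goodᶜ ⊆ bad rowMean ∪ ⋃ j, bad (A j) := by
    intro i hi
    by_contra hnot
    simp only [Set.mem_union, Set.mem_iUnion, not_or, not_exists, bad, Set.mem_ofPred_eq,
      not_lt] at hnot
    apply hi
    have h := abs_mean_sub_sampleMean_le (ε := ε) A i
      (by simpa [rowMean] using hnot.1) (by simpa using hnot.2)
    simpa [hgood] using h
  have hunion : ((bad rowMean ∪ ⋃ j, bad (A j)).ncard : ℝ) ≤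
      (bad rowMean).ncard + ∑ j, ((bad (A j)).ncard : ℝ) := by
    have h1 := Set.ncard_union_le (bad rowMean) (⋃ j, bad (A j))
    have h2 : (⋃ j, bad (A j)).ncard ≤ ∑ j, (bad (A j)).ncard :=
      Set.ncard_iUnion_le_of_fintype _
    exact_mod_cast h1.trans (Nat.add_le_add_left h2 _)
  have hcompl : (goodᶜ.ncard : ℝ) ≤ p * (N : ℝ) ^ M := by
    calc (goodᶜ.ncard : ℝ) ≤ ((bad rowMean ∪ ⋃ j, bad (A j)).ncard : ℝ) := by
          exact_mod_cast Set.ncard_le_ncard hsub (Set.toFinite _)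
      _ ≤ (N : ℝ) ^ M * (p / (2 * N)) + ∑ _j : Fin N, (N : ℝ) ^ M * (p / (2 * N)) :=
          hunion.trans (add_le_add (hbad _ hrowMean)
            (Finset.sum_le_sum fun j _ ↦ hbad _ (hA j)))
      _ = (N + 1) * ((N : ℝ) ^ M * (p / (2 * N))) := by
          rw [Finset.sum_const, Finset.card_univ, Fintype.card_fin, nsmul_eq_mul]
          ring
      _ ≤ (2 * N) * ((N : ℝ) ^ M * (p / (2 * N))) := by
          gcongr
          linarith
      _ = p * (N : ℝ) ^ M := by
          field_simp
  have htotal : (good.ncard : ℝ) + goodᶜ.ncard = (N : ℝ) ^ M := by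
    have h := Set.ncard_add_ncard_compl good
    rw [Nat.card_eq_fintype_card, Fintype.card_fun, Fintype.card_fin, Fintype.card_fin] at h
    exact_mod_cast h
  linarith
end

section
/- Let A ∈ ℝ^{N×N} with all entries in [-1,1], let K ∈ ℕ, and let R ≥ 1 with K/R ∈ ℕ. For each m ∈ {1,...,K} let C*_m ∈ ℝ^{N×N} be any matrix of rank at most m that minimizes the normalized Frobenius error ‖A − C‖_F over all matrices C of rank at most m. If m is sampled uniformly at random from {1,...,K}, then with probability at least 1 − 1/R: ‖A − C*_m‖_□ ≤ ‖A‖_F·√(R/K), where ‖D‖_□ = N^{-2}·max_{U,V ⊆ [N]} |Σ_{i∈U} Σ_{j∈V} d_{ij}| is the normalized matrix cut norm and ‖D‖_F = (N^{-2} Σ_{i,j} d_{ij}²)^{1/2} is the normalized Frobenius norm. -/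
open Finset Matrix

/-- Normalized matrix cut norm `‖D‖_□ = N⁻² max_{U,V ⊆ [N]} |∑_{i∈U} ∑_{j∈V} d_{ij}|`. -/
noncomputable def cutNormN (N : ℕ) (M : Matrix (Fin N) (Fin N) ℝ) : ℝ :=
  (((N : ℝ) ^ 2))⁻¹ *
    ⨆ U : Finset (Fin N), ⨆ V : Finset (Fin N), |∑ i ∈ U, ∑ j ∈ V, M i j|

/-- Normalized Frobenius norm `‖D‖_F = (N⁻² ∑_{i,j} d_{ij}²)^{1/2}`. -/
noncomputable def frobNormN (N : ℕ) (M : Matrix (Fin N) (Fin N) ℝ) : ℝ :=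
  Real.sqrt ((((N : ℝ) ^ 2))⁻¹ * ∑ i, ∑ j, (M i j) ^ 2)

lemma matrix_rank_add_le {m n : Type*} [Fintype m] [Fintype n] {𝕜 : Type*} [Field 𝕜]
    (A B : Matrix m n 𝕜) : (A + B).rank ≤ A.rank + B.rank := by
  rw [Matrix.rank, Matrix.rank, Matrix.rank, Matrix.mulVecLin_add]
  exact (Submodule.finrank_mono (LinearMap.range_add_le _ _)).trans
    (Submodule.finrank_add_le_finrank_add_finrank _ _)

/-- The square of the normalized Frobenius norm. -/
lemma frobNormN_sq (N : ℕ) (M : Matrix (Fin N) (Fin N) ℝ) :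
    frobNormN N M ^ 2 = ((N : ℝ) ^ 2)⁻¹ * ∑ i, ∑ j, M i j ^ 2 :=
  Real.sq_sqrt (by positivity)

lemma frobNormN_nonneg (N : ℕ) (M : Matrix (Fin N) (Fin N) ℝ) : 0 ≤ frobNormN N M :=
  Real.sqrt_nonneg _

/-- The supremum in the cut norm is attained. -/
lemma exists_cutNormN_eq (N : ℕ) (M : Matrix (Fin N) (Fin N) ℝ) :
    ∃ U V : Finset (Fin N), cutNormN N M = ((N : ℝ) ^ 2)⁻¹ * |∑ i ∈ U, ∑ j ∈ V, M i j| := by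
  obtain ⟨U, hU⟩ := exists_eq_ciSup_of_finite
    (f := fun U : Finset (Fin N) => ⨆ V : Finset (Fin N), |∑ i ∈ U, ∑ j ∈ V, M i j|)
  obtain ⟨V, hV⟩ := exists_eq_ciSup_of_finite
    (f := fun V : Finset (Fin N) => |∑ i ∈ U, ∑ j ∈ V, M i j|)
  exact ⟨U, V, by rw [cutNormN, ← hU, ← hV]⟩

/-- Subtracting a suitable matrix of rank at most one lowers the squared Frobenius norm by at least
the squared cut norm. -/
lemma exists_rank_le_one_frobNormN_sq_sub_le (N : ℕ) (M : Matrix (Fin N) (Fin N) ℝ) :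
    ∃ B : Matrix (Fin N) (Fin N) ℝ, B.rank ≤ 1 ∧
      frobNormN N (M - B) ^ 2 ≤ frobNormN N M ^ 2 - cutNormN N M ^ 2 := by
  obtain ⟨U, V, hUV⟩ := exists_cutNormN_eq N M
  set T := ∑ i ∈ U, ∑ j ∈ V, M i j with hT
  set q : ℝ := ((N : ℝ) ^ 2)⁻¹ with hq
  have hq0 : 0 ≤ q := by positivity
  let u : Fin N → ℝ := fun i => if i ∈ U then 1 else 0
  let v : Fin N → ℝ := fun j => if j ∈ V then 1 else 0
  refine ⟨vecMulVec ((q * T) • u) v, rank_vecMulVec_le _ _, ?_⟩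
  have hTsum : ∑ i, ∑ j, M i j * (u i * v j) = T := by
    simp only [u, v, mul_ite, mul_one, mul_zero, Finset.sum_ite_mem,
      Finset.univ_inter, Finset.sum_ite_irrel, Finset.sum_const_zero, hT]
  have hle : ∑ i, ∑ j, (u i * v j) ^ 2 ≤ (N : ℝ) ^ 2 := by
    calc ∑ i, ∑ j, (u i * v j) ^ 2 ≤ ∑ _i : Fin N, ∑ _j : Fin N, (1 : ℝ) := by
          gcongr with i _ j _
          by_cases hi : i ∈ U <;> by_cases hj : j ∈ V <;> simp [u, v, hi, hj]
      _ = (N : ℝ) ^ 2 := by simp [sq]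
  have hexp : ∑ i, ∑ j, (M - vecMulVec ((q * T) • u) v) i j ^ 2 =
      ∑ i, ∑ j, M i j ^ 2 - 2 * (q * T) * T + (q * T) ^ 2 * ∑ i, ∑ j, (u i * v j) ^ 2 := by
    have hpt : ∀ i j, (M - vecMulVec ((q * T) • u) v) i j ^ 2 =
        M i j ^ 2 - 2 * (q * T) * (M i j * (u i * v j)) + (q * T) ^ 2 * (u i * v j) ^ 2 := by
      intro i j
      simp only [Matrix.sub_apply, vecMulVec_apply, Pi.smul_apply, smul_eq_mul]
      ring
    simp only [hpt, Finset.sum_add_distrib, Finset.sum_sub_distrib, ← Finset.mul_sum, hTsum]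
  have hqN : q * (q * (N : ℝ) ^ 2) ≤ q :=
    mul_le_of_le_one_right hq0 (inv_mul_le_one)
  rw [frobNormN_sq, frobNormN_sq, hUV, hexp, mul_pow q |T|, sq_abs, ← hq]
  have h1 := mul_le_mul_of_nonneg_left hle (by positivity : 0 ≤ q * (q * T) ^ 2)
  have h2 := mul_le_mul_of_nonneg_right hqN (by positivity : 0 ≤ q * T ^ 2)
  nlinarith [h1, h2]

/-- The steps `m ≤ n` at which the best approximation has cut-norm error above `t` each use up
`t ^ 2` of the squared Frobenius norm of `A`. -/
lemma exists_rank_le_card_mul_sq_add_le (N : ℕ) (A : Matrix (Fin N) (Fin N) ℝ) (K : ℕ)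
    (Cs : ℕ → Matrix (Fin N) (Fin N) ℝ)
    (hrank : ∀ m ∈ Finset.Icc 1 K, (Cs m).rank ≤ m)
    (hmin : ∀ m ∈ Finset.Icc 1 K, ∀ C : Matrix (Fin N) (Fin N) ℝ,
      C.rank ≤ m → frobNormN N (A - Cs m) ≤ frobNormN N (A - C))
    {t : ℝ} (ht : 0 ≤ t) {n : ℕ} (hn : n ≤ K) :
    ∃ C : Matrix (Fin N) (Fin N) ℝ, C.rank ≤ n + 1 ∧
      (#{m ∈ Finset.Icc 1 n | t < cutNormN N (A - Cs m)} * t ^ 2 + frobNormN N (A - C) ^ 2 <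
          frobNormN N A ^ 2 ∨
        #{m ∈ Finset.Icc 1 n | t < cutNormN N (A - Cs m)} = 0 ∧
          frobNormN N (A - C) ^ 2 ≤ frobNormN N A ^ 2) := by
  induction n with
  | zero => exact ⟨0, by simp, by simp⟩
  | succ n ih =>
    obtain ⟨C, hC, hCA⟩ := ih (by omega)
    have hmem : n + 1 ∈ Finset.Icc 1 K := by simp; omega
    have hsq : frobNormN N (A - Cs (n + 1)) ^ 2 ≤ frobNormN N (A - C) ^ 2 :=
      pow_le_pow_left₀ (frobNormN_nonneg _ _) (hmin _ hmem C hC) 2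
    rw [← Finset.insert_Icc_right_eq_Icc_add_one (by omega), Finset.filter_insert]
    split_ifs with hbad
    · obtain ⟨B, hB, hle⟩ := exists_rank_le_one_frobNormN_sq_sub_le N (A - Cs (n + 1))
      refine ⟨Cs (n + 1) + B, (matrix_rank_add_le _ _).trans (add_le_add (hrank _ hmem) hB), Or.inl ?_⟩
      have hlt : t ^ 2 < cutNormN N (A - Cs (n + 1)) ^ 2 := pow_lt_pow_left₀ hbad ht two_ne_zero
      rw [Finset.card_insert_of_notMem (by simp), ← sub_sub]
      push_cast
      rcases hCA with h | ⟨h0, h⟩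
      · linarith
      · rw [h0]; push_cast; linarith
    · refine ⟨Cs (n + 1), (hrank _ hmem).trans (by omega), ?_⟩
      rcases hCA with h | ⟨h0, h⟩
      · left; linarith
      · exact Or.inr ⟨h0, hsq.trans h⟩

/-- **Cut-norm guarantee for best rank-`m` Frobenius approximations.**
Let `A ∈ [-1,1]^{N×N}`, `K ∈ ℕ`, `R ≥ 1` with `K/R ∈ ℕ`, and for each `m ∈ {1,…,K}` let
`Cs m` be a matrix of rank at most `m` minimizing the normalized Frobenius error
`‖A - C‖_F` over matrices `C` of rank at most `m`. If `m` is sampled uniformly from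
`{1,…,K}` (stated via counting), then with probability at least `1 - 1/R`,
`‖A - Cs m‖_□ ≤ ‖A‖_F·√(R/K)`. -/
theorem svd_cut_norm_bound
    (N : ℕ) (A : Matrix (Fin N) (Fin N) ℝ)
    (hA : ∀ i j, A i j ∈ Set.Icc (-1 : ℝ) 1)
    (K : ℕ) (R : ℝ) (hR : 1 ≤ R) (hKR : ∃ j : ℕ, (K : ℝ) = R * (j : ℝ))
    (Cs : ℕ → Matrix (Fin N) (Fin N) ℝ)
    (hrank : ∀ m ∈ Finset.Icc 1 K, (Cs m).rank ≤ m)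
    (hmin : ∀ m ∈ Finset.Icc 1 K, ∀ C : Matrix (Fin N) (Fin N) ℝ,
      C.rank ≤ m → frobNormN N (A - Cs m) ≤ frobNormN N (A - C)) :
    ((Set.ncard {m : ℕ | m ∈ Finset.Icc 1 K ∧
        cutNormN N (A - Cs m) ≤ frobNormN N A * Real.sqrt (R / (K : ℝ))} : ℝ)
      ≥ (1 - 1 / R) * K) := by
  rcases Nat.eq_zero_or_pos K with rfl | hK
  · simp
  have hR0 : 0 < R := by linarith
  have hK0 : (0 : ℝ) < K := by exact_mod_cast hK
  set t := frobNormN N A * Real.sqrt (R / (K : ℝ)) with ht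
  have ht0 : 0 ≤ t := mul_nonneg (frobNormN_nonneg _ _) (Real.sqrt_nonneg _)
  have htsq : t ^ 2 = frobNormN N A ^ 2 * (R / K) := by
    rw [ht, mul_pow, Real.sq_sqrt (by positivity)]
  have hset : {m : ℕ | m ∈ Finset.Icc 1 K ∧ cutNormN N (A - Cs m) ≤ t} =
      ({m ∈ Finset.Icc 1 K | ¬ t < cutNormN N (A - Cs m)} : Finset ℕ) := by
    ext m; simp
  rw [hset, Set.ncard_coe_finset]
  have hcard : (#{m ∈ Finset.Icc 1 K | t < cutNormN N (A - Cs m)} : ℝ) +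
      #{m ∈ Finset.Icc 1 K | ¬ t < cutNormN N (A - Cs m)} = K := by
    have := Finset.card_filter_add_card_filter_not (s := Finset.Icc 1 K)
      (fun m => t < cutNormN N (A - Cs m))
    rw [Nat.card_Icc, Nat.add_sub_cancel] at this
    exact_mod_cast this
  suffices hbad : (#{m ∈ Finset.Icc 1 K | t < cutNormN N (A - Cs m)} : ℝ) ≤ K / R by
    have : (1 - 1 / R) * K = K - K / R := by ring
    linarith
  obtain ⟨C, -, h | ⟨h0, -⟩⟩ :=
    exists_rank_le_card_mul_sq_add_le N A K Cs hrank hmin ht0 le_rfl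
  · rw [htsq] at h
    by_contra! hlt
    have hone : 1 ≤ (#{m ∈ Finset.Icc 1 K | t < cutNormN N (A - Cs m)} : ℝ) * (R / K) := by
      have := mul_le_mul_of_nonneg_right hlt.le (by positivity : 0 ≤ R / (K : ℝ))
      rwa [div_mul_div_cancel₀ hR0.ne', div_self hK0.ne'] at this
    nlinarith [sq_nonneg (frobNormN N (A - C)), sq_nonneg (frobNormN N A)]
  · rw [h0, Nat.cast_zero]
    positivity
end

section
/- Let N, M, K, D ∈ ℕ with M ≥ 1, Γ > 0, α > 0. Let A ∈ [0,1]^{N×N}, Q ∈ (0,1]^{N×N} with μ = 1/Σ_{i,j} q_{ij}, and let U, V ∈ [0,1]^{N×K}, r ∈ [0,1]^K be such that all entries of C = U·diag(r)·Vᵀ lie in [0,1]. Fix k ∈ {1,...,K}, and let n_1,...,n_M be independent uniform samples from {1,...,N}. Then for every 0 < p₁ < 1, with probability at least 1 − p₁: |(2α(1+Γ)μ/N²)·Σ_{i,j=1}^N (c_{ij} − a_{ij})·q_{ij}·u_{ik}·v_{jk} − (2α(1+Γ)μ/M²)·Σ_{i,j=1}^M (c_{n_i,n_j} − a_{n_i,n_j})·q_{n_i,n_j}·u_{n_i,k}·v_{n_j,k}|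 ≤ 4α(1+Γ)μ·√((2·log(1/p₁) + 2·log(2N) + 2·log 2)/M). -/
open Finset Matrix

/-- Hoeffding's lemma for the uniform distribution on a finite type. -/
lemma sum_exp_le_of_sum_eq_zero {ι : Type*} [Fintype ι] [Nonempty ι] (g : ι → ℝ) (a b : ℝ)
    (hg : ∀ i, g i ∈ Set.Icc a b) (h0 : ∑ i, g i = 0) (t : ℝ) :
    ∑ i, Real.exp (t * g i) ≤
      Fintype.card ι * Real.exp (((b - a) / 2) ^ 2 * t ^ 2 / 2) := by
  let _ : MeasurableSpace ι := ⊤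
  have hcard : (0 : ℝ) < Fintype.card ι := by exact_mod_cast Fintype.card_pos
  let P : MeasureTheory.Measure ι := ProbabilityTheory.uniformOn Set.univ
  have : MeasureTheory.IsProbabilityMeasure P :=
    ProbabilityTheory.isProbabilityMeasure_uniformOn Set.finite_univ Set.univ_nonempty
  have hint (f : ι → ℝ) : ∫ i, f i ∂P = (Fintype.card ι : ℝ)⁻¹ * ∑ i, f i := by
    rw [MeasureTheory.integral_fintype (MeasureTheory.Integrable.of_finite), Finset.mul_sum]
    refine Finset.sum_congr rfl fun i _ => ?_
    simp [P, MeasureTheory.measureReal_def, ProbabilityTheory.uniformOn_univ]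
  have hsub := ProbabilityTheory.hasSubgaussianMGF_of_mem_Icc_of_integral_eq_zero
    (μ := P) (X := g) (a := a) (b := b) (measurable_from_top.aemeasurable)
    (Filter.Eventually.of_forall hg) (by rw [hint, h0, mul_zero])
  have h := hsub.mgf_le t
  rw [ProbabilityTheory.mgf, hint, inv_mul_le_iff₀ hcard] at h
  simpa [div_pow] using h

/-- One-sided Hoeffding inequality, by counting sample tuples. -/
lemma card_filter_lt_sum_le {ι : Type*} [Fintype ι] [Nonempty ι] {M : ℕ}
    (g : ι → ℝ) (a b : ℝ) (hab : b - a = 2)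
    (hg : ∀ i, g i ∈ Set.Icc a b) (h0 : ∑ i, g i = 0) (ε : ℝ) (hε : 0 ≤ ε) :
    ((Finset.univ.filter fun n : Fin M → ι => M * ε < ∑ l, g (n l)).card : ℝ) ≤
      Real.exp (-(M * ε ^ 2 / 2)) * (Fintype.card ι : ℝ) ^ M := by
  have hsum : ∑ n : Fin M → ι, Real.exp (ε * ∑ l, g (n l)) =
      (∑ i, Real.exp (ε * g i)) ^ M := by
    rw [Fintype.sum_pow]
    refine Finset.sum_congr rfl fun n _ => ?_
    rw [Finset.mul_sum, Real.exp_sum]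
  have hmgf : (∑ i, Real.exp (ε * g i)) ^ M ≤
      (Fintype.card ι * Real.exp (ε ^ 2 / 2)) ^ M := by
    refine pow_le_pow_left₀ (Finset.sum_nonneg fun i _ => (Real.exp_pos _).le) ?_ _
    simpa [hab] using sum_exp_le_of_sum_eq_zero g a b hg h0 ε
  have hmarkov : ((Finset.univ.filter fun n : Fin M → ι => M * ε < ∑ l, g (n l)).card : ℝ) *
      Real.exp (ε * (M * ε)) ≤ ∑ n : Fin M → ι, Real.exp (ε * ∑ l, g (n l)) := by
    rw [← nsmul_eq_mul]
    refine (Finset.card_nsmul_le_sum _ _ _ fun n hn => ?_).trans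
      (Finset.sum_le_sum_of_subset_of_nonneg (Finset.filter_subset _ _)
        fun n _ _ => (Real.exp_pos _).le)
    exact Real.exp_le_exp.2 (mul_le_mul_of_nonneg_left (Finset.mem_filter.1 hn).2.le hε)
  have hle := hmarkov.trans (hsum.le.trans hmgf)
  rw [← le_div_iff₀ (Real.exp_pos _)] at hle
  refine hle.trans_eq ?_
  rw [mul_pow, ← Real.exp_nat_mul, mul_div_assoc, ← Real.exp_sub, mul_comm]
  congr 2
  ring

/-- Two-sided Hoeffding inequality for functions with values in `[-1, 1]`, by counting sample
tuples. -/
lemma card_filter_lt_abs_mean_sub_le {ι : Type*} [Fintype ι] [Nonempty ι] {M : ℕ} (hM : 0 < M)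
    (f : ι → ℝ) (hf : ∀ i, |f i| ≤ 1) (ε : ℝ) (hε : 0 ≤ ε) :
    ((Finset.univ.filter fun n : Fin M → ι =>
        ε < |(∑ i, f i) / Fintype.card ι - (∑ l, f (n l)) / M|).card : ℝ) ≤
      2 * Real.exp (-(M * ε ^ 2 / 2)) * (Fintype.card ι : ℝ) ^ M := by
  classical
  have hcard : (0 : ℝ) < Fintype.card ι := by exact_mod_cast Fintype.card_pos
  have hM' : (0 : ℝ) < M := by exact_mod_cast hM
  set m := (∑ i, f i) / Fintype.card ι with hm
  have hm0 : Fintype.card ι * m = ∑ i, f i := by rw [hm]; field_simp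
  have h1 := card_filter_lt_sum_le (M := M) (fun i => f i - m) (-1 - m) (1 - m) (by ring)
    (fun i => by have := abs_le.1 (hf i); constructor <;> linarith)
    (by simp [hm0]) ε hε
  have h2 := card_filter_lt_sum_le (M := M) (fun i => m - f i) (m - 1) (m + 1) (by ring)
    (fun i => by have := abs_le.1 (hf i); constructor <;> linarith)
    (by simp [hm0]) ε hε
  have hsub : (Finset.univ.filter fun n : Fin M → ι => ε < |m - (∑ l, f (n l)) / M|) ⊆
      (Finset.univ.filter fun n : Fin M → ι => M * ε < ∑ l, (f (n l) - m)) ∪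
      (Finset.univ.filter fun n : Fin M → ι => M * ε < ∑ l, (m - f (n l))) := by
    intro n hn
    simp only [Finset.mem_union, Finset.mem_filter, Finset.mem_univ, true_and,
      Finset.sum_sub_distrib, Finset.sum_const, Finset.card_univ, Fintype.card_fin,
      nsmul_eq_mul] at hn ⊢
    have hs : ∑ l, f (n l) = M * ((∑ l, f (n l)) / M) := by field_simp
    rw [hs, ← mul_sub, ← mul_sub, mul_lt_mul_iff_right₀ hM', mul_lt_mul_iff_right₀ hM']
    rcases lt_abs.1 hn with h | h
    · exact Or.inr h
    · exact Or.inl (by linarith)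
  have hle : _ ≤ (_ : ℝ) := Nat.cast_le.2 ((Finset.card_le_card hsub).trans
    (Finset.card_union_le _ _))
  push_cast at hle
  linarith

/-- Two-dimensional Monte Carlo bound, by counting sample tuples. -/
lemma card_filter_lt_abs_double_mean_sub_le {ι : Type*} [Fintype ι] [Nonempty ι] {M : ℕ}
    (hM : 0 < M) (e : ι → ι → ℝ) (he : ∀ i j, |e i j| ≤ 1) (ε : ℝ) (hε : 0 ≤ ε) :
    ((Finset.univ.filter fun n : Fin M → ι =>
        2 * ε < |(∑ i, ∑ j, e i j) / (Fintype.card ι : ℝ) ^ 2 -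
          (∑ i, ∑ j, e (n i) (n j)) / (M : ℝ) ^ 2|).card : ℝ) ≤
      (Fintype.card ι + 1) *
        (2 * Real.exp (-(M * ε ^ 2 / 2)) * (Fintype.card ι : ℝ) ^ M) := by
  classical
  have hcard : (0 : ℝ) < Fintype.card ι := by exact_mod_cast Fintype.card_pos
  have hM' : (0 : ℝ) < M := by exact_mod_cast hM
  let rowMean : ι → ℝ := fun i => (∑ j, e i j) / Fintype.card ι
  have hrow (i : ι) : |rowMean i| ≤ 1 := by
    rw [abs_div, abs_of_pos hcard, div_le_one hcard]
    refine (Finset.abs_sum_le_sum_abs _ _).trans ?_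
    simpa using Finset.sum_le_card_nsmul Finset.univ (fun j => |e i j|) 1 fun j _ => he i j
  let bad : (ι → ℝ) → Finset (Fin M → ι) := fun f => Finset.univ.filter fun n =>
    ε < |(∑ i, f i) / Fintype.card ι - (∑ l, f (n l)) / M|
  have hbad (f : ι → ℝ) (hf : ∀ i, |f i| ≤ 1) := card_filter_lt_abs_mean_sub_le hM f hf ε hε
  have hsub : (Finset.univ.filter fun n : Fin M → ι =>
        2 * ε < |(∑ i, ∑ j, e i j) / (Fintype.card ι : ℝ) ^ 2 -
          (∑ i, ∑ j, e (n i) (n j)) / (M : ℝ) ^ 2|) ⊆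
      (Finset.univ.biUnion fun i => bad (e i)) ∪ bad rowMean := by
    intro n hn
    by_contra hgood
    simp only [bad, Finset.mem_union, Finset.mem_biUnion, Finset.mem_filter, Finset.mem_univ,
      true_and, not_or, not_exists, not_lt] at hn hgood
    obtain ⟨hrows, hmean⟩ := hgood
    have hinner : |(∑ l, rowMean (n l)) / M - (∑ i, ∑ j, e (n i) (n j)) / (M : ℝ) ^ 2| ≤ ε := by
      have hrw : (∑ l, rowMean (n l)) / M - (∑ i, ∑ j, e (n i) (n j)) / (M : ℝ) ^ 2 =
          (∑ l, (rowMean (n l) - (∑ j, e (n l) (n j)) / M)) / M := by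
        rw [Finset.sum_sub_distrib, ← Finset.sum_div _ fun l => ∑ j, e (n l) (n j), sub_div,
          div_div, sq]
      rw [hrw, abs_div, abs_of_pos hM', div_le_iff₀ hM', mul_comm]
      refine (Finset.abs_sum_le_sum_abs _ _).trans ?_
      simpa using Finset.sum_le_card_nsmul Finset.univ _ ε fun l _ => hrows (n l)
    have houter : (∑ i, rowMean i) / Fintype.card ι =
        (∑ i, ∑ j, e i j) / (Fintype.card ι : ℝ) ^ 2 := by
      simp only [rowMean]
      rw [← Finset.sum_div, div_div, sq]
    rw [houter] at hmean
    linarith [abs_sub_le ((∑ i, ∑ j, e i j) / (Fintype.card ι : ℝ) ^ 2)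
      ((∑ l, rowMean (n l)) / M) ((∑ i, ∑ j, e (n i) (n j)) / (M : ℝ) ^ 2)]
  have hle : _ ≤ (_ : ℝ) := Nat.cast_le.2 ((Finset.card_le_card hsub).trans
    ((Finset.card_union_le _ _).trans (Nat.add_le_add_right Finset.card_biUnion_le _)))
  push_cast at hle
  refine hle.trans ?_
  rw [add_one_mul]
  refine add_le_add ?_ (hbad _ hrow)
  simpa using Finset.sum_le_card_nsmul Finset.univ _ _ fun i _ => hbad (e i) (he i)

/-- **Monte Carlo approximation of the magnitude gradient of the IBG loss.**
The discrepancy between the partial derivative with respect to `r_k` of the full IBG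
fitting loss (graph part) and of the subsampled loss on the random subgraph induced by
`M` independent uniform samples `n_1, …, n_M` from `{1,…,N}` is at most
`4α(1+Γ)μ·√((2 log(1/p₁) + 2 log(2N) + 2 log 2)/M)` with probability at least `1 - p₁`
(stated by counting sample tuples). -/
theorem sgd_magnitude_gradient_bound
    (N M K D : ℕ) (hN : 0 < N) (hM : 1 ≤ M)
    (Γ α : ℝ) (hΓ : 0 < Γ) (hα : 0 < α)
    (A : Matrix (Fin N) (Fin N) ℝ) (hA : ∀ i j, A i j ∈ Set.Icc (0 : ℝ) 1)
    (Q : Matrix (Fin N) (Fin N) ℝ) (hQ : ∀ i j, Q i j ∈ Set.Ioc (0 : ℝ) 1)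
    (μ : ℝ) (hμ : μ = (∑ i, ∑ j, Q i j)⁻¹)
    (U V : Matrix (Fin N) (Fin K) ℝ)
    (hU : ∀ i k, U i k ∈ Set.Icc (0 : ℝ) 1) (hV : ∀ i k, V i k ∈ Set.Icc (0 : ℝ) 1)
    (r : Fin K → ℝ) (hr : ∀ k, r k ∈ Set.Icc (0 : ℝ) 1)
    (C : Matrix (Fin N) (Fin N) ℝ) (hCdef : ∀ i j, C i j = ∑ k, U i k * r k * V j k)
    (hC : ∀ i j, C i j ∈ Set.Icc (0 : ℝ) 1)
    (k : Fin K)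
    (p₁ : ℝ) (hp0 : 0 < p₁) (hp1 : p₁ < 1) :
    ((Set.ncard {n : Fin M → Fin N |
        |2 * α * (1 + Γ) * μ / (N : ℝ) ^ 2 *
            ∑ i, ∑ j, (C i j - A i j) * Q i j * U i k * V j k
          - 2 * α * (1 + Γ) * μ / (M : ℝ) ^ 2 *
              ∑ i : Fin M, ∑ j : Fin M,
                (C (n i) (n j) - A (n i) (n j)) * Q (n i) (n j) * U (n i) k * V (n j) k| ≤
          4 * α * (1 + Γ) * μ *
            Real.sqrt ((2 * Real.log (1 / p₁) + 2 * Real.log (2 * N) + 2 * Real.log 2) / M)} : ℝ)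
      ≥ (1 - p₁) * (N : ℝ) ^ M) := by
  have : Nonempty (Fin N) := ⟨⟨0, hN⟩⟩
  have hM' : (0 : ℝ) < M := by exact_mod_cast hM
  have hN' : (1 : ℝ) ≤ N := by exact_mod_cast hN
  have hμ0 : 0 ≤ μ := by
    rw [hμ]
    exact inv_nonneg.2 (Finset.sum_nonneg fun i _ => Finset.sum_nonneg fun j _ => (hQ i j).1.le)
  set ε := Real.sqrt ((2 * Real.log (1 / p₁) + 2 * Real.log (2 * N) + 2 * Real.log 2) / M) with hε
  let e : Fin N → Fin N → ℝ := fun i j => (C i j - A i j) * Q i j * U i k * V j k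
  have he (i j : Fin N) : |e i j| ≤ 1 := by
    have h1 : |C i j - A i j| ≤ 1 := by
      have := hC i j
      have := hA i j
      simp only [Set.mem_Icc] at *
      exact abs_le.2 ⟨by linarith, by linarith⟩
    simp only [e, abs_mul, abs_of_nonneg (hQ i j).1.le, abs_of_nonneg (hU i k).1,
      abs_of_nonneg (hV j k).1]
    exact mul_le_one₀ (mul_le_one₀ (mul_le_one₀ h1 (hQ i j).1.le (hQ i j).2) (hU i k).1
      (hU i k).2) (hV j k).1 (hV j k).2
  have hbound := card_filter_lt_abs_double_mean_sub_le (M := M) hM e he ε (Real.sqrt_nonneg _)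
  have hexp : Real.exp (-(M * ε ^ 2 / 2)) = p₁ / (4 * N) := by
    have hlog0 : 0 ≤ Real.log (1 / p₁) := Real.log_nonneg (by rw [le_div_iff₀ hp0]; linarith)
    have hlog1 : 0 ≤ Real.log (2 * N) := Real.log_nonneg (by linarith)
    have hlog2 : 0 ≤ Real.log 2 := Real.log_nonneg one_le_two
    rw [hε, Real.sq_sqrt (by positivity)]
    have harg : -(M * ((2 * Real.log (1 / p₁) + 2 * Real.log (2 * N) + 2 * Real.log 2) / M) / 2) =
        -(Real.log (1 / p₁) + Real.log (2 * N) + Real.log 2) := by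
      field_simp
    rw [harg, ← Real.log_mul (by positivity) (by positivity),
      ← Real.log_mul (by positivity) (by positivity), Real.exp_neg, Real.exp_log (by positivity)]
    field_simp
    norm_num
  rw [hexp, Fintype.card_fin] at hbound
  have hfail : ((N : ℝ) + 1) * (2 * (p₁ / (4 * N)) * (N : ℝ) ^ M) ≤ p₁ * (N : ℝ) ^ M := by
    rw [← mul_assoc]
    refine mul_le_mul_of_nonneg_right ?_ (by positivity)
    rw [show ((N : ℝ) + 1) * (2 * (p₁ / (4 * N))) = (N + 1) * p₁ / (2 * N) by
        field_simp; norm_num, div_le_iff₀ (by positivity)]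
    nlinarith
  have hcompl := Finset.card_filter_add_card_filter_not
    (s := (Finset.univ : Finset (Fin M → Fin N)))
    (fun n => 2 * ε < |(∑ i, ∑ j, e i j) / (N : ℝ) ^ 2 -
      (∑ i, ∑ j, e (n i) (n j)) / (M : ℝ) ^ 2|)
  rw [Finset.card_univ, Fintype.card_fun, Fintype.card_fin, Fintype.card_fin] at hcompl
  have hcompl' : _ = (_ : ℝ) := congrArg Nat.cast hcompl
  push_cast at hcompl'
  have hmono := Set.ncard_le_ncard
    (s := ↑(Finset.univ.filter fun n : Fin M → Fin N =>
      ¬ 2 * ε < |(∑ i, ∑ j, e i j) / (N : ℝ) ^ 2 - (∑ i, ∑ j, e (n i) (n j)) / (M : ℝ) ^ 2|))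
    (t := {n : Fin M → Fin N |
        |2 * α * (1 + Γ) * μ / (N : ℝ) ^ 2 * ∑ i, ∑ j, e i j
          - 2 * α * (1 + Γ) * μ / (M : ℝ) ^ 2 * ∑ i, ∑ j, e (n i) (n j)| ≤
          4 * α * (1 + Γ) * μ * ε}) (fun n hn => by
      have hc : 0 ≤ 2 * α * (1 + Γ) * μ := by positivity
      simp only [Finset.coe_filter, Finset.mem_univ, true_and, Set.mem_ofPred_eq, not_lt] at hn ⊢
      rw [div_mul_eq_mul_div, div_mul_eq_mul_div, mul_div_assoc, mul_div_assoc, ← mul_sub,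
        abs_mul, abs_of_nonneg hc]
      linarith [mul_le_mul_of_nonneg_left hn hc]) (Set.toFinite _)
  rw [Set.ncard_coe_finset] at hmono
  have hmono' : _ ≤ (_ : ℝ) := Nat.cast_le.2 hmono
  refine ge_iff_le.2 (le_trans ?_ hmono')
  linarith
end
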